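/- Let u¹, u², u³, u⁴ : ℝ² → ℝ be arbitrary differentiable functions. With F₄ = [[2,−1,0,0],[−1,2,−1,0],[0,−2,2,−1],[0,0,−1,2]], J̃ = [[2,2,1,1],[0,2,1,1],[0,0,1,1],[0,0,0,1]], J₄ the 4×4 upper-triangular all-ones matrix, S₂ = diag(0, 2e^{u¹+u²}, 2e^{u²+u³}, e^{u³+u⁴}) and R₂ = diag(0, ∂_yu¹+∂_yu², ∂_yu²+∂_yu³, ∂_yu³+∂_yu⁴): for every matrix function B : ℝ² → M₄(ℝ) whose entries outside the first column vanish identically, the matrices X₂ := F₄·J̃⁻¹·S₂·(J₄⁻¹)ᵀ and a₂ := (−F₄·J̃⁻¹·R₂ + B)·J̃·F₄⁻¹ satisfy ∂_y X₂ + a₂·X₂ = 0 at every point (∂_y entrywise). -/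

import Mathlib

open Matrix

noncomputable section

/-- Entrywise partial derivative with respect to the second variable `y`. -/
def dyMat {n : ℕ} (F : ℝ × ℝ → Matrix (Fin n) (Fin n) ℝ) (p : ℝ × ℝ) :
    Matrix (Fin n) (Fin n) ℝ :=
  Matrix.of fun i j => deriv (fun t => F (p.1, t) i j) p.2

/-- Partial derivative of a scalar function with respect to `y`. -/
def dy (f : ℝ × ℝ → ℝ) (p : ℝ × ℝ) : ℝ := deriv (fun t => f (p.1, t)) p.2

/-- The Cartan matrix `F₄`. -/
def F4M : Matrix (Fin 4) (Fin 4) ℝ :=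
  !![2, -1, 0, 0; -1, 2, -1, 0; 0, -2, 2, -1; 0, 0, -1, 2]

/-- The matrix `J̃`. -/
def Jt : Matrix (Fin 4) (Fin 4) ℝ :=
  !![2, 2, 1, 1; 0, 2, 1, 1; 0, 0, 1, 1; 0, 0, 0, 1]

/-- The `4 × 4` upper-triangular all-ones matrix `J₄`. -/
def J4 : Matrix (Fin 4) (Fin 4) ℝ :=
  !![1, 1, 1, 1; 0, 1, 1, 1; 0, 0, 1, 1; 0, 0, 0, 1]

theorem dyMat_mul_diagonal_mul {n : ℕ} (A C : Matrix (Fin n) (Fin n) ℝ)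
    (s : ℝ × ℝ → Fin n → ℝ) (s' : Fin n → ℝ) (p : ℝ × ℝ)
    (hs : ∀ k, HasDerivAt (fun t => s (p.1, t) k) (s' k) p.2) :
    dyMat (fun q => A * diagonal (s q) * C) p = A * diagonal s' * C := by
  ext i j
  have h : HasDerivAt (fun t => ∑ k, A i k * s (p.1, t) k * C k j)
      (∑ k, A i k * s' k * C k j) p.2 :=
    HasDerivAt.fun_sum fun k _ => ((hs k).const_mul (A i k)).mul_const (C k j)
  simpa only [dyMat, of_apply, mul_apply (N := C), mul_diagonal] using h.deriv

theorem hasDerivAt_dy {u : ℝ × ℝ → ℝ} (hu : Differentiable ℝ u) (p : ℝ × ℝ) :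
    HasDerivAt (fun t => u (p.1, t)) (dy u p) p.2 := by
  have h : Differentiable ℝ fun t : ℝ => u (p.1, t) := by fun_prop
  exact (h p.2).hasDerivAt

theorem hasDerivAt_exp_add {u v : ℝ × ℝ → ℝ} (hu : Differentiable ℝ u)
    (hv : Differentiable ℝ v) (p : ℝ × ℝ) :
    HasDerivAt (fun t => Real.exp (u (p.1, t) + v (p.1, t)))
      (Real.exp (u p + v p) * (dy u p + dy v p)) p.2 :=
  ((hasDerivAt_dy hu p).add (hasDerivAt_dy hv p)).exp

theorem isUnit_det_F4M : IsUnit F4M.det := by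
  have h : F4M.det = 1 := by
    simp [F4M, det_succ_row_zero, Fin.sum_univ_succ, Fin.succAbove]
    norm_num
  simp [h]

theorem isUnit_det_Jt : IsUnit Jt.det := by
  have h : Jt.det = 4 := by
    simp [Jt, det_succ_row_zero, Fin.sum_univ_succ, Fin.succAbove]
    norm_num
  simp [h]

/-- For arbitrary differentiable `u¹,…,u⁴` and any `B` vanishing outside its first
column, `X₂ = F₄J̃⁻¹S₂(J₄⁻¹)ᵀ` and `a₂ = (−F₄J̃⁻¹R₂ + B)J̃F₄⁻¹` satisfy
`∂_y X₂ + a₂·X₂ = 0`. -/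
theorem f4_second_laplace_equation_solutions
    (u1 u2 u3 u4 : ℝ × ℝ → ℝ)
    (hu1 : Differentiable ℝ u1) (hu2 : Differentiable ℝ u2)
    (hu3 : Differentiable ℝ u3) (hu4 : Differentiable ℝ u4)
    (B : ℝ × ℝ → Matrix (Fin 4) (Fin 4) ℝ)
    (hB : ∀ (p : ℝ × ℝ) (i j : Fin 4), j ≠ 0 → B p i j = 0) :
    ∀ p : ℝ × ℝ,
      dyMat (fun q =>
          F4M * Jt⁻¹ *
            Matrix.diagonal ![0, 2 * Real.exp (u1 q + u2 q), 2 * Real.exp (u2 q + u3 q),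
              Real.exp (u3 q + u4 q)] * (J4⁻¹)ᵀ) p +
        ((-(F4M * Jt⁻¹ *
            Matrix.diagonal ![0, dy u1 p + dy u2 p, dy u2 p + dy u3 p,
              dy u3 p + dy u4 p]) + B p) * Jt * F4M⁻¹) *
          (F4M * Jt⁻¹ *
            Matrix.diagonal ![0, 2 * Real.exp (u1 p + u2 p), 2 * Real.exp (u2 p + u3 p),
              Real.exp (u3 p + u4 p)] * (J4⁻¹)ᵀ) = 0 := by
  intro p
  set S : Fin 4 → ℝ := ![0, 2 * Real.exp (u1 p + u2 p), 2 * Real.exp (u2 p + u3 p),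
    Real.exp (u3 p + u4 p)] with hS
  set R : Fin 4 → ℝ := ![0, dy u1 p + dy u2 p, dy u2 p + dy u3 p, dy u3 p + dy u4 p] with hR
  rw [dyMat_mul_diagonal_mul _ _ _ (R * S) p]
  · have hBS : B p * diagonal S = 0 := by
      ext i j
      rw [mul_diagonal]
      by_cases hj : j = 0
      · simp [hj, hS]
      · simp [hB p i j hj]
    have hcancel : Jt * F4M⁻¹ * (F4M * Jt⁻¹) = 1 := by
      rw [Matrix.mul_assoc, nonsing_inv_mul_cancel_left _ _ isUnit_det_F4M,
        mul_nonsing_inv _ isUnit_det_Jt]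
    have hX (M : Matrix (Fin 4) (Fin 4) ℝ) :
        M * Jt * F4M⁻¹ * (F4M * Jt⁻¹ * diagonal S * (J4⁻¹)ᵀ) = M * diagonal S * (J4⁻¹)ᵀ := by
      calc _ = M * (Jt * F4M⁻¹ * (F4M * Jt⁻¹)) * diagonal S * (J4⁻¹)ᵀ := by
            simp only [Matrix.mul_assoc]
        _ = _ := by rw [hcancel, Matrix.mul_one]
    have hRS : diagonal (R * S) = diagonal R * diagonal S := (diagonal_mul_diagonal' R S).symm
    rw [hX, Matrix.add_mul, hBS, hRS, add_zero, Matrix.neg_mul, Matrix.neg_mul,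
      Matrix.mul_assoc _ (diagonal R), add_neg_cancel]
  · intro k
    match k with
    | 0 => simpa [hS, hR] using hasDerivAt_const p.2 (0 : ℝ)
    | 1 =>
      refine ((hasDerivAt_exp_add hu1 hu2 p).const_mul 2).congr_deriv ?_
      simp [hS, hR]; ring
    | 2 =>
      refine ((hasDerivAt_exp_add hu2 hu3 p).const_mul 2).congr_deriv ?_
      simp [hS, hR]; ring
    | 3 =>
      refine (hasDerivAt_exp_add hu3 hu4 p).congr_deriv ?_
      simp [hS, hR]; ring

end
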